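/- arXiv:1801.02968 — 2 statements merged into one kernel-verified Lean document; each statement's English description precedes it below -/
import Mathlib

section
/- Let s be a finite multiset of integers, each at least 3, with card s ≥ 3 and combinatorial curvature Φ(s) = 1 − (card s)/2 + Σ_{k ∈ s} 1/k ≥ 0. If s contains an element D with D ≥ 43, then s is one of the following multisets: {3,3,D}, {3,4,D}, {3,5,D}, {3,6,D}, {4,4,D}, {3,3,3,D}. Consequently Φ(s) ≥ 1/D. -/
/-- Combinatorial curvature of a vertex pattern `s` (multiset of face degrees). -/
def curvature (s : Multiset ℤ) : ℚ :=
  1 - (s.card : ℚ) / 2 + (s.map (fun k => (1 : ℚ) / (k : ℚ))).sum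

/-- `curvature` with the reciprocals taken directly over the integer multiset, rather than over its
monadic lift to `ℚ`. -/
theorem curvature_eq (s : Multiset ℤ) :
    curvature s = 1 - (s.card : ℚ) / 2 + (s.map (fun k : ℤ => (1 : ℚ) / (k : ℚ))).sum := by
  simp [curvature, Multiset.bind_def, Multiset.pure_def, Multiset.bind_singleton,
    Multiset.map_map]

theorem curvature_cons (D : ℤ) (t : Multiset ℤ) :
    curvature (D ::ₘ t) =
      1 / (D : ℚ) + (1 - (t.card : ℚ)) / 2 + (t.map (fun k : ℤ => (1 : ℚ) / (k : ℚ))).sum := by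
  simp only [curvature_eq, Multiset.card_cons, Multiset.map_cons, Multiset.sum_cons]
  push_cast
  ring

theorem one_div_intCast_le {m k : ℤ} (hm : 0 < m) (hmk : m ≤ k) :
    1 / (k : ℚ) ≤ 1 / (m : ℚ) :=
  one_div_le_one_div_of_le (by exact_mod_cast hm) (by exact_mod_cast hmk)

/-- A pattern of nonnegative curvature with a face of degree at least `43` has at most three
other faces. -/
theorem card_le_three_of_curvature_nonneg {D : ℤ} {t : Multiset ℤ} (hD : 43 ≤ D)
    (ht : ∀ k ∈ t, (3 : ℤ) ≤ k) (hΦ : 0 ≤ curvature (D ::ₘ t)) : t.card ≤ 3 := by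
  have hsum : (t.map (fun k : ℤ => (1 : ℚ) / (k : ℚ))).sum ≤ t.card * (1 / 3) := by
    simpa using Multiset.sum_le_card_nsmul (t.map fun k : ℤ => (1 : ℚ) / (k : ℚ)) (1 / 3) (by
      simp only [Multiset.mem_map]
      rintro _ ⟨k, hk, rfl⟩
      simpa using one_div_intCast_le (by norm_num) (ht k hk))
  have hD' := one_div_intCast_le (by norm_num) hD
  rw [curvature_cons] at hΦ
  push_cast at hD'
  by_contra! h
  have h4 : (4 : ℚ) ≤ t.card := by exact_mod_cast h
  linarith

theorem pair_of_reciprocal_sum {a b : ℤ} (ha : 3 ≤ a) (hab : a ≤ b)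
    (h : 1 / 2 - 1 / 43 ≤ 1 / (a : ℚ) + 1 / (b : ℚ)) :
    (a = 3 ∧ b ≤ 6) ∨ (a = 4 ∧ b = 4) := by
  have ha4 : a ≤ 4 := by
    by_contra! h5
    have h1 := one_div_intCast_le (m := 5) (by norm_num) h5
    have h2 := one_div_intCast_le (m := 5) (by norm_num) (by omega : (5 : ℤ) ≤ b)
    push_cast at h1 h2
    linarith
  obtain rfl | rfl : a = 3 ∨ a = 4 := by omega
  · refine Or.inl ⟨rfl, ?_⟩
    by_contra! h7
    have h1 := one_div_intCast_le (m := 7) (by norm_num) h7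
    push_cast at h h1
    linarith
  · refine Or.inr ⟨rfl, le_antisymm ?_ hab⟩
    by_contra! h5
    have h1 := one_div_intCast_le (m := 5) (by norm_num) h5
    push_cast at h h1
    linarith

theorem eq_three_of_reciprocal_sum {a b c : ℤ} (ha : 3 ≤ a) (hb : 3 ≤ b) (hc : 3 ≤ c)
    (h : 1 - 1 / 43 ≤ 1 / (a : ℚ) + 1 / (b : ℚ) + 1 / (c : ℚ)) : a = 3 := by
  by_contra hne
  have h1 := one_div_intCast_le (m := 4) (k := a) (by norm_num) (by omega)
  have h2 := one_div_intCast_le (by norm_num) hb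
  have h3 := one_div_intCast_le (by norm_num) hc
  push_cast at h1 h2 h3
  linarith

theorem patterns_with_large_face (s : Multiset ℤ)
    (h3 : ∀ k ∈ s, (3 : ℤ) ≤ k) (hcard : 3 ≤ Multiset.card s)
    (hΦ : 0 ≤ curvature s) (D : ℤ) (hD : D ∈ s) (hD43 : 43 ≤ D) :
    (s = {3, 3, D} ∨ s = {3, 4, D} ∨ s = {3, 5, D} ∨ s = {3, 6, D} ∨
      s = {4, 4, D} ∨ s = {3, 3, 3, D}) ∧ 1 / (D : ℚ) ≤ curvature s := by
  have hclass : s = {3, 3, D} ∨ s = {3, 4, D} ∨ s = {3, 5, D} ∨ s = {3, 6, D} ∨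
      s = {4, 4, D} ∨ s = {3, 3, 3, D} := by
    obtain ⟨t, rfl⟩ := Multiset.exists_cons_of_mem hD
    have ht : ∀ k ∈ t, (3 : ℤ) ≤ k := fun k hk => h3 k (Multiset.mem_cons_of_mem hk)
    have hle := card_le_three_of_curvature_nonneg hD43 ht hΦ
    have hD' := one_div_intCast_le (by norm_num) hD43
    push_cast at hD'
    rw [curvature_cons] at hΦ
    rw [Multiset.card_cons] at hcard
    obtain h2 | h3 : t.card = 2 ∨ t.card = 3 := by omega
    · obtain ⟨a, b, rfl, hab⟩ : ∃ a b : ℤ, t = {a, b} ∧ a ≤ b := by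
        obtain ⟨a, b, rfl⟩ := Multiset.card_eq_two.1 h2
        rcases le_total a b with hab | hba
        · exact ⟨a, b, rfl, hab⟩
        · exact ⟨b, a, Multiset.pair_comm a b, hba⟩
      have hpair : D ::ₘ {a, b} = ({a, b, D} : Multiset ℤ) := by
        simp only [Multiset.insert_eq_cons, Multiset.cons_swap D a]
        rw [← Multiset.insert_eq_cons D, Multiset.pair_comm, Multiset.insert_eq_cons]
      have hb : 3 ≤ b := ht b (by simp)
      simp only [Multiset.insert_eq_cons, Multiset.card_cons, Multiset.card_singleton,
        Multiset.map_cons, Multiset.map_singleton, Multiset.sum_cons,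
        Multiset.sum_singleton] at hΦ
      push_cast at hΦ
      rw [hpair]
      rcases pair_of_reciprocal_sum (ht a (by simp)) hab (by linarith) with
        ⟨rfl, hb6⟩ | ⟨rfl, rfl⟩
      · interval_cases b <;> simp
      · simp
    · obtain ⟨a, b, c, rfl⟩ := Multiset.card_eq_three.1 h3
      have ha : 3 ≤ a := ht a (by simp)
      have hb : 3 ≤ b := ht b (by simp)
      have hc : 3 ≤ c := ht c (by simp)
      simp only [Multiset.insert_eq_cons, Multiset.card_cons, Multiset.card_singleton,
        Multiset.map_cons, Multiset.map_singleton, Multiset.sum_cons,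
        Multiset.sum_singleton] at hΦ
      push_cast at hΦ
      obtain rfl := eq_three_of_reciprocal_sum ha hb hc (by linarith)
      obtain rfl := eq_three_of_reciprocal_sum hb ha hc (by linarith)
      obtain rfl := eq_three_of_reciprocal_sum hc ha hb (by linarith)
      iterate 5 right
      simp only [Multiset.insert_eq_cons, Multiset.cons_swap D 3]
      rw [← Multiset.insert_eq_cons D, Multiset.pair_comm, Multiset.insert_eq_cons]
  refine ⟨hclass, ?_⟩
  rcases hclass with rfl | rfl | rfl | rfl | rfl | rfl <;>
  · simp only [curvature_eq, Multiset.insert_eq_cons, Multiset.card_cons, Multiset.card_singleton,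
      Multiset.map_cons, Multiset.map_singleton, Multiset.sum_cons, Multiset.sum_singleton]
    push_cast
    linarith
end

section
/- Let s be a finite multiset of integers, each at least 3, with card s ≥ 3 and combinatorial curvature Φ(s) = 1 − (card s)/2 + Σ_{k ∈ s} 1/k ≥ 0. If the element 7 occurs in s with multiplicity at least 2, then s = {3,7,7} or s = {4,7,7}; in both cases Φ(s) ≥ 1/28. -/
theorem curvature_zero : curvature 0 = 1 := by
  simp [curvature]

theorem curvature_cons_s14 (a : ℤ) (s : Multiset ℤ) :
    curvature (a ::ₘ s) = curvature s + (1 / (a : ℚ) - 1 / 2) := by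
  simp only [curvature, Multiset.card_cons, Multiset.bind_def, Multiset.pure_def,
    Multiset.cons_bind, Multiset.singleton_add, Multiset.map_cons, Multiset.sum_cons]
  push_cast
  ring

theorem one_div_le_third {a : ℤ} (ha : 3 ≤ a) : 1 / (a : ℚ) ≤ 1 / 3 :=
  one_div_le_one_div_of_le (by norm_num) (by exact_mod_cast ha)

theorem curvature_le {s : Multiset ℤ} (h3 : ∀ k ∈ s, (3 : ℤ) ≤ k) :
    curvature s ≤ 1 - (s.card : ℚ) / 6 := by
  induction s using Multiset.induction_on with
  | empty => simp [curvature_zero]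
  | cons a s ih =>
    have hs := ih fun k hk => h3 k (Multiset.mem_cons_of_mem hk)
    have ha := one_div_le_third (h3 a (Multiset.mem_cons_self a s))
    rw [curvature_cons_s14, Multiset.card_cons]
    push_cast
    linarith

theorem patterns_with_two_sevens (s : Multiset ℤ)
    (h3 : ∀ k ∈ s, (3 : ℤ) ≤ k) (hcard : 3 ≤ Multiset.card s)
    (hΦ : 0 ≤ curvature s) (h7 : 2 ≤ s.count (7 : ℤ)) :
    (s = {3, 7, 7} ∨ s = {4, 7, 7}) ∧ 1 / 28 ≤ curvature s := by
  obtain ⟨u, rfl⟩ := Multiset.le_iff_exists_add.1 (Multiset.le_count_iff_replicate_le.1 h7)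
  have hs : Multiset.replicate 2 (7 : ℤ) + u = 7 ::ₘ 7 ::ₘ u := by
    simp [Multiset.replicate_succ]
  rw [hs] at h3 hcard hΦ ⊢
  have hu := curvature_le fun k hk =>
    h3 k (Multiset.mem_cons_of_mem (Multiset.mem_cons_of_mem hk))
  simp only [curvature_cons_s14, Multiset.card_cons] at hΦ hcard ⊢
  push_cast at hΦ ⊢
  have hlt : (u.card : ℚ) < 2 := by linarith
  have hu1 : u.card = 1 := by
    have : u.card < 2 := by exact_mod_cast hlt
    omega
  obtain ⟨a, rfl⟩ := Multiset.card_eq_one.1 hu1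
  have ha3 : 3 ≤ a := h3 a (by simp)
  rw [← Multiset.cons_zero, curvature_cons_s14, curvature_zero] at hΦ ⊢
  have ha4 : a ≤ 4 := by
    by_contra! h
    have : 1 / (a : ℚ) ≤ 1 / 5 :=
      one_div_le_one_div_of_le (by norm_num) (by exact_mod_cast h)
    linarith
  interval_cases a
  · exact ⟨Or.inl (by decide), by norm_num⟩
  · exact ⟨Or.inr (by decide), by norm_num⟩
end
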